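/- Let (Q,P) be a weakly quasi-lattice ordered group and let Λ be a P-graph with FA(Λ) ≠ ∅. Then the boundary-path space BPS(Λ) is closed in PS(Λ), and it is invariant for the semigroup action: if m,n ∈ P, x ∈ D_m and y ∈ D_n ∩ BPS(Λ) satisfy x·m = y·n, then x ∈ BPS(Λ). -/

import Mathlib

set_option autoImplicit false

/-- The topology on the power set `Set α` obtained by identifying it with the
product `∏ _ : α, Prop` where each (two-point) factor `Prop` carries the
discrete topology. -/
instance powersetTopology (α : Type) : TopologicalSpace (Set α) :=
  @Pi.topologicalSpace α (fun _ => Prop) (fun _ => ⊥)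

/-- The cylinder `Z(K₁;K₂) = {x : K₁ ⊆ x ⊆ K₂ᶜ}`. -/
def cylinder {α : Type} (K₁ K₂ : Set α) : Set (Set α) :=
  {x | K₁ ⊆ x ∧ x ⊆ K₂ᶜ}

/-- The relation `p ≤ r` iff `p * q = r` for some `q ∈ P`. -/
def Submonoid.leftLE {Q : Type} [Group Q] (P : Submonoid Q) (p r : Q) : Prop :=
  ∃ q ∈ P, p * q = r

/-- A weakly quasi-lattice ordered group `(Q,P)`: a group `Q` together with a
subsemigroup `P` containing the unit with `P ∩ P⁻¹ = {e}`, such that any two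
elements of `P` with a common upper bound (for `leftLE`) have a least common
upper bound. -/
structure WQLO (Q : Type) [Group Q] where
  P : Submonoid Q
  inter_inv : ∀ p ∈ P, p⁻¹ ∈ P → p = 1
  lub : ∀ a ∈ P, ∀ b ∈ P, (∃ c ∈ P, P.leftLE a c ∧ P.leftLE b c) →
    ∃ l ∈ P, P.leftLE a l ∧ P.leftLE b l ∧
      ∀ c ∈ P, P.leftLE a c → P.leftLE b c → P.leftLE l c

/-- A (discrete) `P`-graph: a countable small category, presented by its set of
morphisms `Λ` with range map `r`, source map `s` and a composition `mul`
(constrained by the axioms only on composable pairs, i.e. when `s μ = r ν`),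
together with a degree functor `d : Λ → P` satisfying the unique factorisation
property. The units of `Λ` are exactly the elements of the form `r lam`. -/
structure PGraph (Q : Type) [Group Q] (W : WQLO Q) where
  Λ : Type
  countable : Countable Λ
  r : Λ → Λ
  s : Λ → Λ
  mul : Λ → Λ → Λ
  d : Λ → Q
  d_mem : ∀ lam, d lam ∈ W.P
  s_r : ∀ lam, s (r lam) = r lam
  r_r : ∀ lam, r (r lam) = r lam
  s_s : ∀ lam, s (s lam) = s lam
  r_s : ∀ lam, r (s lam) = s lam
  id_mul : ∀ lam, mul (r lam) lam = lam
  mul_id : ∀ lam, mul lam (s lam) = lam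
  r_mul : ∀ mu nu, s mu = r nu → r (mul mu nu) = r mu
  s_mul : ∀ mu nu, s mu = r nu → s (mul mu nu) = s nu
  mul_assoc : ∀ mu nu k, s mu = r nu → s nu = r k →
    mul (mul mu nu) k = mul mu (mul nu k)
  d_unit : ∀ lam, d (r lam) = 1
  d_mul : ∀ mu nu, s mu = r nu → d (mul mu nu) = d mu * d nu
  factor : ∀ lam, ∀ p ∈ W.P, ∀ q ∈ W.P, d lam = p * q →
    ∃! mn : Λ × Λ, s mn.1 = r mn.2 ∧ mul mn.1 mn.2 = lam ∧ d mn.1 = p ∧ d mn.2 = q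

namespace PGraph

variable {Q : Type} [Group Q] {W : WQLO Q} (G : PGraph Q W)

/-- `λΛ = {λμ : μ ∈ Λ, s λ = r μ}`. -/
def cone (lam : G.Λ) : Set G.Λ :=
  {x | ∃ mu, G.s lam = G.r mu ∧ x = G.mul lam mu}

/-- `λE = {λμ : μ ∈ E, s λ = r μ}`. -/
def coneSet (lam : G.Λ) (E : Set G.Λ) : Set G.Λ :=
  {x | ∃ mu ∈ E, G.s lam = G.r mu ∧ x = G.mul lam mu}

/-- `Λ` is finitely aligned at the pair `(μ,ν)`. -/
def FinAlignedAtPair (mu nu : G.Λ) : Prop :=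
  ∃ J : Finset G.Λ, G.cone mu ∩ G.cone nu = ⋃ lam ∈ (J : Set G.Λ), G.cone lam

/-- `Λ` is finitely aligned at `λ`. -/
def FinAlignedAt (lam : G.Λ) : Prop :=
  ∀ mu ∈ G.cone lam, ∀ nu : G.Λ, G.FinAlignedAtPair mu nu

/-- The finitely aligned part `FA(Λ)`. -/
def FA : Set G.Λ := {lam | G.FinAlignedAt lam}

/-- `FAr(Λ) = FA(Λ) ∪ r(FA(Λ))`. -/
def FAr : Set G.Λ := G.FA ∪ G.r '' G.FA

/-- `μ ≼ λ` iff `μν = λ` for some `ν`. -/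
def pre (mu lam : G.Λ) : Prop :=
  ∃ nu, G.s mu = G.r nu ∧ G.mul mu nu = lam

/-- A filter: a nonempty, hereditary and directed subset of `Λ`. -/
def IsFilter (x : Set G.Λ) : Prop :=
  x.Nonempty ∧ (∀ lam mu, G.pre lam mu → mu ∈ x → lam ∈ x) ∧
    ∀ mu ∈ x, ∀ nu ∈ x, ∃ lam ∈ x, G.pre mu lam ∧ G.pre nu lam

/-- The space `ℱΛ` of filters, with the subspace topology from `𝒫(Λ)`. -/
abbrev FilterSpace := {x : Set G.Λ // G.IsFilter x}

/-- `Z_{ℱΛ}(μ;K) = {x ∈ ℱΛ : μ ∈ x ⊆ Λ∖K}`. -/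
def Zf (mu : G.Λ) (K : Set G.Λ) : Set G.FilterSpace :=
  {x | mu ∈ x.1 ∧ x.1 ⊆ Kᶜ}

/-- An ultrafilter: a filter maximal with respect to inclusion. -/
def IsUltrafilter (x : Set G.Λ) : Prop :=
  G.IsFilter x ∧ ∀ y, G.IsFilter y → x ⊆ y → x = y

/-- The path space `PS(Λ)`: filters meeting `FA(Λ)` (as a set of subsets). -/
def PS : Set (Set G.Λ) := {x | G.IsFilter x ∧ (x ∩ G.FA).Nonempty}

/-- The path space as a topological space (subspace of `𝒫(Λ)`). -/
abbrev PSpace := {x : Set G.Λ // x ∈ G.PS}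

/-- The boundary-path space: the closure in `PS(Λ)` of the set of ultrafilters
lying in `PS(Λ)`. -/
def BPS : Set G.PSpace := closure {x : G.PSpace | G.IsUltrafilter x.1}

abbrev BPSpace := {x : G.PSpace // x ∈ G.BPS}

/-- The left shift `λ⁻¹·x = {μ : λμ ∈ x}`. -/
def lshift (lam : G.Λ) (x : Set G.Λ) : Set G.Λ :=
  {mu | G.s lam = G.r mu ∧ G.mul lam mu ∈ x}

/-- The right shift `λ·x = {ζ : ζ ≼ λμ for some μ ∈ x}`. -/
def rshift (lam : G.Λ) (x : Set G.Λ) : Set G.Λ :=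
  {z | ∃ mu ∈ x, G.s lam = G.r mu ∧ G.pre z (G.mul lam mu)}

/-- The action `x·m`: the left shift of `x` by the unique element of
`x ∩ Λ^m` (when it exists). -/
def act (x : Set G.Λ) (m : Q) : Set G.Λ :=
  ⋃ lam ∈ {l ∈ x | G.d l = m}, G.lshift lam x

/-- The domain `D_m = {x ∈ PS(Λ) : x ∩ Λ^m ≠ ∅}` of `T_m`. -/
def Dom (m : Q) : Set (Set G.Λ) := {x ∈ G.PS | ∃ l ∈ x, G.d l = m}

/-- The range `R_m = {x·m : x ∈ D_m}` of `T_m`. -/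
def Ran (m : Q) : Set (Set G.Λ) := {y | ∃ x ∈ G.Dom m, G.act x m = y}

variable {G}

theorem pre_refl (a : G.Λ) : G.pre a a := ⟨G.s a, (G.r_s a).symm, G.mul_id a⟩

theorem pre_trans {a b c : G.Λ} (hab : G.pre a b) (hbc : G.pre b c) : G.pre a c := by
  obtain ⟨p, hp, rfl⟩ := hab
  obtain ⟨q, hq, rfl⟩ := hbc
  rw [G.s_mul _ _ hp] at hq
  exact ⟨G.mul p q, by rw [G.r_mul _ _ hq, hp], (G.mul_assoc _ _ _ hp hq).symm⟩

theorem pre_mul {a b : G.Λ} (h : G.s a = G.r b) : G.pre a (G.mul a b) := ⟨b, h, rfl⟩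

theorem pre.r_eq {a b : G.Λ} (h : G.pre a b) : G.r a = G.r b := by
  obtain ⟨p, hp, rfl⟩ := h
  exact (G.r_mul _ _ hp).symm

theorem mem_cone_iff {a b : G.Λ} : b ∈ G.cone a ↔ G.pre a b :=
  ⟨fun ⟨c, hc, h⟩ => ⟨c, hc, h.symm⟩, fun ⟨c, hc, h⟩ => ⟨c, hc, h.symm⟩⟩

theorem mul_left_cancel {l a b : G.Λ} (ha : G.s l = G.r a) (hb : G.s l = G.r b)
    (h : G.mul l a = G.mul l b) : a = b := by
  have hd : G.d a = G.d b := by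
    have h' := congrArg G.d h
    rw [G.d_mul _ _ ha, G.d_mul _ _ hb] at h'
    exact _root_.mul_left_cancel h'
  have := (G.factor (G.mul l a) (G.d l) (G.d_mem l) (G.d a) (G.d_mem a)
    (G.d_mul _ _ ha)).unique (y₁ := (l, a)) (y₂ := (l, b))
    ⟨ha, rfl, rfl, rfl⟩ ⟨hb, h.symm, rfl, hd.symm⟩
  exact congrArg Prod.snd this

theorem mul_pre_mul_iff {l a b : G.Λ} (ha : G.s l = G.r a) (hb : G.s l = G.r b) :
    G.pre (G.mul l a) (G.mul l b) ↔ G.pre a b := by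
  constructor
  · rintro ⟨c, hc, h⟩
    rw [G.s_mul _ _ ha] at hc
    rw [G.mul_assoc _ _ _ ha hc] at h
    exact ⟨c, hc, mul_left_cancel (by rw [G.r_mul _ _ hc, ha]) hb h⟩
  · rintro ⟨c, hc, rfl⟩
    exact ⟨c, by rw [G.s_mul _ _ ha, hc], G.mul_assoc _ _ _ ha hc⟩

theorem pre.eq_of_d_eq {a b c : G.Λ} (ha : G.pre a c) (hb : G.pre b c) (h : G.d a = G.d b) :
    a = b := by
  obtain ⟨p, hp, rfl⟩ := ha
  obtain ⟨q, hq, hpq⟩ := hb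
  have hd : G.d q = G.d p := by
    have h' := congrArg G.d hpq
    rw [G.d_mul _ _ hp, G.d_mul _ _ hq, h] at h'
    exact _root_.mul_left_cancel h'
  have := (G.factor (G.mul a p) (G.d a) (G.d_mem a) (G.d p) (G.d_mem p)
    (G.d_mul _ _ hp)).unique (y₁ := (a, p)) (y₂ := (b, q))
    ⟨hp, rfl, rfl, rfl⟩ ⟨hq, hpq, h.symm, hd⟩
  exact congrArg Prod.fst this

theorem FA_of_pre {a b : G.Λ} (ha : a ∈ G.FA) (h : G.pre a b) : b ∈ G.FA := fun mu hmu nu =>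
  ha mu (mem_cone_iff.2 (pre_trans h (mem_cone_iff.1 hmu))) nu

theorem IsFilter.s_mem_lshift {x : Set G.Λ} {l : G.Λ} (hl : l ∈ x) : G.s l ∈ G.lshift l x :=
  ⟨(G.r_s l).symm, by rwa [G.mul_id]⟩

theorem IsFilter.r_eq {x : Set G.Λ} (hx : G.IsFilter x) {a b : G.Λ} (ha : a ∈ x) (hb : b ∈ x) :
    G.r a = G.r b := by
  obtain ⟨c, -, hac, hbc⟩ := hx.2.2 a ha b hb
  rw [hac.r_eq, hbc.r_eq]

theorem IsFilter.exists_pre_mul {x : Set G.Λ} (hx : G.IsFilter x) {l a : G.Λ} (hl : l ∈ x)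
    (ha : a ∈ x) : ∃ b ∈ G.lshift l x, G.pre a (G.mul l b) := by
  obtain ⟨c, hc, ⟨b, hb, rfl⟩, hac⟩ := hx.2.2 l hl a ha
  exact ⟨b, ⟨hb, hc⟩, hac⟩

theorem IsFilter.lshift {x : Set G.Λ} (hx : G.IsFilter x) {l : G.Λ} (hl : l ∈ x) :
    G.IsFilter (G.lshift l x) := by
  refine ⟨⟨_, s_mem_lshift hl⟩, ?_, ?_⟩
  · rintro a b hab ⟨hb, hbx⟩
    have ha : G.s l = G.r a := by rw [hb, hab.r_eq]
    exact ⟨ha, hx.2.1 _ _ ((mul_pre_mul_iff ha hb).2 hab) hbx⟩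
  · rintro a ⟨ha, hax⟩ b ⟨hb, hbx⟩
    obtain ⟨c, hc, hac, hbc⟩ := hx.2.2 _ hax _ hbx
    obtain ⟨e, he, rfl⟩ := pre_trans (pre_mul ha) hac
    exact ⟨e, ⟨he, hc⟩, (mul_pre_mul_iff ha he).1 hac, (mul_pre_mul_iff hb he).1 hbc⟩

theorem IsFilter.rshift {y : Set G.Λ} (hy : G.IsFilter y) {l : G.Λ} (hl : G.s l ∈ y) :
    G.IsFilter (G.rshift l y) := by
  refine ⟨⟨l, _, hl, (G.r_s l).symm, by rw [G.mul_id]; exact pre_refl l⟩, ?_, ?_⟩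
  · rintro a b hab ⟨c, hc, hlc, hbc⟩
    exact ⟨c, hc, hlc, pre_trans hab hbc⟩
  · rintro a ⟨a', ha', hla, ha⟩ b ⟨b', hb', hlb, hb⟩
    obtain ⟨c, hc, hac, hbc⟩ := hy.2.2 _ ha' _ hb'
    have hlc : G.s l = G.r c := by rw [hla, hac.r_eq]
    exact ⟨G.mul l c, ⟨c, hc, hlc, pre_refl _⟩,
      pre_trans ha ((mul_pre_mul_iff hla hlc).2 hac),
      pre_trans hb ((mul_pre_mul_iff hlb hlc).2 hbc)⟩

theorem IsFilter.rshift_lshift {x : Set G.Λ} (hx : G.IsFilter x) {l : G.Λ} (hl : l ∈ x) :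
    G.rshift l (G.lshift l x) = x := by
  ext a
  constructor
  · rintro ⟨b, ⟨-, hb⟩, -, hab⟩
    exact hx.2.1 _ _ hab hb
  · intro ha
    obtain ⟨b, hb, hab⟩ := hx.exists_pre_mul hl ha
    exact ⟨b, hb, hb.1, hab⟩

theorem IsFilter.lshift_rshift {y : Set G.Λ} (hy : G.IsFilter y) {l : G.Λ} (hl : G.s l ∈ y) :
    G.lshift l (G.rshift l y) = y := by
  ext a
  constructor
  · rintro ⟨ha, b, hb, hlb, hab⟩
    exact hy.2.1 _ _ ((mul_pre_mul_iff ha hlb).1 hab) hb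
  · intro ha
    have hla : G.s l = G.r a := by rw [← G.r_s, hy.r_eq hl ha]
    exact ⟨hla, a, ha, hla, pre_refl _⟩

theorem lshift_mono (l : G.Λ) {x y : Set G.Λ} (h : x ⊆ y) : G.lshift l x ⊆ G.lshift l y :=
  fun _ ha => ⟨ha.1, h ha.2⟩

theorem rshift_mono (l : G.Λ) {x y : Set G.Λ} (h : x ⊆ y) : G.rshift l x ⊆ G.rshift l y :=
  fun _ ⟨a, ha, h'⟩ => ⟨a, h ha, h'⟩

theorem mem_rshift {y : Set G.Λ} {l : G.Λ} (hl : G.s l ∈ y) : l ∈ G.rshift l y :=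
  ⟨_, hl, (G.r_s l).symm, by rw [G.mul_id]; exact pre_refl l⟩

theorem IsUltrafilter.lshift {u : Set G.Λ} (hu : G.IsUltrafilter u) {l : G.Λ} (hl : l ∈ u) :
    G.IsUltrafilter (G.lshift l u) := by
  refine ⟨hu.1.lshift hl, fun y hy huy => ?_⟩
  have hly : G.s l ∈ y := huy (IsFilter.s_mem_lshift hl)
  have h : u = G.rshift l y := hu.2 _ (hy.rshift hly) (by
    rw [← hu.1.rshift_lshift hl]
    exact rshift_mono l huy)
  rw [h, hy.lshift_rshift hly]

theorem IsUltrafilter.rshift {u : Set G.Λ} (hu : G.IsUltrafilter u) {l : G.Λ} (hl : G.s l ∈ u) :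
    G.IsUltrafilter (G.rshift l u) := by
  refine ⟨hu.1.rshift hl, fun y hy huy => ?_⟩
  have hly : l ∈ y := huy (mem_rshift hl)
  have h : u = G.lshift l y := hu.2 _ (hy.lshift hly) (by
    rw [← hu.1.lshift_rshift hl]
    exact lshift_mono l huy)
  rw [h, hy.rshift_lshift hly]

theorem IsFilter.act_eq {x : Set G.Λ} (hx : G.IsFilter x) {l : G.Λ} (hl : l ∈ x) :
    G.act x (G.d l) = G.lshift l x := by
  ext a
  simp only [act, Set.mem_iUnion, Set.mem_ofPred_eq]
  constructor
  · rintro ⟨k, ⟨hk, hd⟩, ha⟩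
    obtain ⟨c, -, hkc, hlc⟩ := hx.2.2 _ hk _ hl
    rwa [← hkc.eq_of_d_eq hlc hd]
  · exact fun ha => ⟨l, ⟨hl, rfl⟩, ha⟩

theorem IsFilter.exists_upper_bound {x : Set G.Λ} (hx : G.IsFilter x) (I : Finset G.Λ)
    {a : G.Λ} (ha : a ∈ x) : ∃ b ∈ x, G.pre a b ∧ ∀ k ∈ I, k ∈ x → G.pre k b := by
  classical
  induction I using Finset.induction_on with
  | empty => exact ⟨a, ha, pre_refl a, by simp⟩
  | insert k I _ ih =>
    obtain ⟨b, hb, hab, hI⟩ := ih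
    by_cases hk : k ∈ x
    · obtain ⟨c, hc, hbc, hkc⟩ := hx.2.2 _ hb _ hk
      refine ⟨c, hc, pre_trans hab hbc, fun i hi hix => ?_⟩
      rcases Finset.mem_insert.1 hi with rfl | hi
      · exact hkc
      · exact pre_trans (hI i hi hix) hbc
    · refine ⟨b, hb, hab, fun i hi hix => ?_⟩
      rcases Finset.mem_insert.1 hi with rfl | hi
      · exact absurd hix hk
      · exact hI i hi hix

/-- If `a ∈ FA(Λ)` lies in the filter `x` and `I` is finite, then finitely many extensions of `a`
outside `x` detect membership of the elements of `I \ x` in filters containing `a`. -/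
theorem IsFilter.exists_finset_avoid {x : Set G.Λ} (hx : G.IsFilter x) (I : Finset G.Λ)
    {a : G.Λ} (ha : a ∈ G.FA) : ∃ J : Finset G.Λ, (∀ j ∈ J, G.pre a j ∧ j ∉ x) ∧
      ∀ w, G.IsFilter w → a ∈ w → (∀ j ∈ J, j ∉ w) → ∀ k ∈ I, k ∉ x → k ∉ w := by
  classical
  choose J hJ using fun k => ha a (mem_cone_iff.2 (pre_refl a)) k
  have hJ' : ∀ k, ∀ j ∈ J k, G.pre a j ∧ G.pre k j := by
    intro k j hj
    have : j ∈ G.cone a ∩ G.cone k := by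
      rw [hJ k]
      exact Set.mem_biUnion (Finset.mem_coe.2 hj) (mem_cone_iff.2 (pre_refl j))
    exact ⟨mem_cone_iff.1 this.1, mem_cone_iff.1 this.2⟩
  refine ⟨(I.filter (· ∉ x)).biUnion J, fun j hj => ?_, fun w hw haw hJw k hk hkx hkw => ?_⟩
  · obtain ⟨k, hk, hj⟩ := Finset.mem_biUnion.1 hj
    exact ⟨(hJ' k j hj).1, fun hjx => (Finset.mem_filter.1 hk).2 (hx.2.1 _ _ (hJ' k j hj).2 hjx)⟩
  · obtain ⟨c, hc, hac, hkc⟩ := hw.2.2 _ haw _ hkw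
    have hc' : c ∈ G.cone a ∩ G.cone k := ⟨mem_cone_iff.2 hac, mem_cone_iff.2 hkc⟩
    rw [hJ k] at hc'
    obtain ⟨j, hj, hjc⟩ := Set.mem_iUnion₂.1 hc'
    exact hJw j (Finset.mem_biUnion.2 ⟨k, Finset.mem_filter.2 ⟨hk, hkx⟩, hj⟩)
      (hw.2.1 _ _ (mem_cone_iff.1 hjc) hc)

end PGraph

theorem isOpen_setOf_eval {α : Type} (a : α) (S : Set Prop) :
    IsOpen {x : Set α | (a ∈ x) ∈ S} :=
  let _ : TopologicalSpace Prop := ⊥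
  haveI : DiscreteTopology Prop := ⟨rfl⟩
  (isOpen_discrete S).preimage (continuous_apply (A := fun _ : α => Prop) a)

theorem isOpen_setOf_mem {α : Type} (a : α) : IsOpen {x : Set α | a ∈ x} := by
  simpa using isOpen_setOf_eval a {True}

theorem isOpen_setOf_notMem {α : Type} (a : α) : IsOpen {x : Set α | a ∉ x} := by
  simpa using isOpen_setOf_eval a {False}

theorem IsOpen.exists_finset_forall_mem_iff {α : Type} {o : Set (Set α)} (ho : IsOpen o)
    {x : Set α} (hx : x ∈ o) :
    ∃ I : Finset α, ∀ w : Set α, (∀ i ∈ I, i ∈ w ↔ i ∈ x) → w ∈ o := by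
  let _ : TopologicalSpace Prop := ⊥
  obtain ⟨I, u, hu, hI⟩ := (isOpen_pi_iff (A := fun _ : α => Prop)).1 ho x hx
  refine ⟨I, fun w hw => hI fun i hi => ?_⟩
  have : w i = x i := propext (hw i hi)
  rw [this]
  exact (hu i hi).2

/-- The boundary-path space `BPS(Λ)` is closed in `PS(Λ)` and invariant for
the semigroup action: if `x ∈ D_m`, `y ∈ D_n ∩ BPS(Λ)` and `x·m = y·n`, then
`x ∈ BPS(Λ)`. -/
theorem statement17 {Q : Type} [Group Q] {W : WQLO Q} (G : PGraph Q W)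
    (hne : G.FA.Nonempty) :
    IsClosed G.BPS ∧
    ∀ m ∈ W.P, ∀ n ∈ W.P, ∀ x y : G.PSpace,
      x.1 ∈ G.Dom m → y.1 ∈ G.Dom n → y ∈ G.BPS →
      G.act x.1 m = G.act y.1 n → x ∈ G.BPS := by
  refine ⟨isClosed_closure, ?_⟩
  rintro m - n - ⟨x, hx, κ, hκx, hκ⟩ ⟨y, hy, hyFA⟩ ⟨-, l, hlx, rfl⟩ ⟨-, k, hky, rfl⟩ hyB hact
  change l ∈ x at hlx
  change k ∈ y at hky
  change G.act x (G.d l) = G.act y (G.d k) at hact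
  rw [hx.act_eq hlx, hy.act_eq hky] at hact
  have hlk : G.s l = G.s k := by
    have h := PGraph.IsFilter.s_mem_lshift hlx
    rw [hact] at h
    rw [← G.r_s l, ← h.1]
  refine mem_closure_iff.2 fun o ho hxo => ?_
  obtain ⟨o, ho', rfl⟩ := isOpen_induced_iff.1 ho
  obtain ⟨I, hI⟩ := ho'.exists_finset_forall_mem_iff (x := x) hxo
  obtain ⟨c, hc, hκc, hlc⟩ := hx.2.2 _ hκx _ hlx
  obtain ⟨a, hax, hca, haI⟩ := hx.exists_upper_bound I hc
  have haFA : a ∈ G.FA := PGraph.FA_of_pre hκ (PGraph.pre_trans hκc hca)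
  obtain ⟨J, hJ, hJw⟩ := hx.exists_finset_avoid I haFA
  have hla := PGraph.pre_trans hlc hca
  obtain ⟨b, hb, rfl⟩ := hla
  have hmem : ∀ e, G.s l = G.r e → (G.mul l e ∈ x ↔ G.mul k e ∈ y) := by
    intro e he
    have h := Set.ext_iff.1 hact e
    exact ⟨fun h' => (h.1 ⟨he, h'⟩).2, fun h' => (h.2 ⟨hlk ▸ he, h'⟩).2⟩
  choose! t ht htj using fun j hj => PGraph.pre_trans (PGraph.pre_mul hb) (hJ j hj).1
  have hopen : IsOpen {u : G.PSpace | G.mul k b ∈ u.1 ∧ ∀ j ∈ J, G.mul k (t j) ∉ u.1} := by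
    have h : IsOpen ({u : Set G.Λ | G.mul k b ∈ u} ∩ ⋂ j ∈ J, {u | G.mul k (t j) ∉ u}) :=
      (isOpen_setOf_mem _).inter (isOpen_biInter_finset fun j _ => isOpen_setOf_notMem _)
    convert h.preimage continuous_subtype_val using 1
    ext u
    simp
  obtain ⟨⟨u, huPS⟩, ⟨hbu, hJu⟩, huU⟩ := mem_closure_iff.1 hyB _ hopen
    ⟨(hmem b hb).1 hax, fun j hj h => (hJ j hj).2
      (by rw [← htj j hj]; exact (hmem _ (ht j hj)).2 h)⟩
  change G.mul k b ∈ u at hbu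
  change ∀ j ∈ J, G.mul k (t j) ∉ u at hJu
  change G.IsUltrafilter u at huU
  have hku : k ∈ u := huU.1.2.1 _ _ (PGraph.pre_mul (hlk ▸ hb)) hbu
  have hz := huU.lshift hku
  have hlz : G.s l ∈ G.lshift k u := hlk ▸ PGraph.IsFilter.s_mem_lshift hku
  have hw := hz.rshift hlz
  have haw : G.mul l b ∈ G.rshift l (G.lshift k u) :=
    ⟨b, ⟨hlk ▸ hb, hbu⟩, hb, PGraph.pre_refl _⟩
  have hJw' : ∀ j ∈ J, j ∉ G.rshift l (G.lshift k u) := by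
    intro j hj hjw
    rw [← htj j hj] at hjw
    have h : t j ∈ G.lshift l (G.rshift l (G.lshift k u)) := ⟨ht j hj, hjw⟩
    rw [hz.1.lshift_rshift hlz] at h
    exact hJu j hj h.2
  refine ⟨⟨_, hw.1, _, haw, haFA⟩, hI _ fun i hi => ⟨fun hiw => ?_, fun hix => ?_⟩, hw⟩
  · by_contra hix
    exact hJw _ hw.1 haw hJw' i hi hix hiw
  · exact hw.1.2.1 _ _ (haI i hi hix) haw
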